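/- arXiv:1307.2842 — 2 statements merged into one kernel-verified Lean document; each statement's English description precedes it below -/
import Mathlib

section
/- For each fixed x ∈ ℝ, the power series m_{L1}(x,λ,z) = Σ_{n≥0} m_{L1}^n(x) z^{2n} converges absolutely and uniformly on every compact subset of ℂ; the map z ↦ m_{L1}(x,λ,z) is entire and even; it satisfies |m_{L1}(x,λ,z)| ≤ cosh(|z| ∫_x^{+∞} a(s) ds) for all x ∈ ℝ and z ∈ ℂ; and it solves the Volterra integral equation m_{L1}(x,λ,z) = 1 + z² ∫_x^{+∞} ∫_y^{+∞} e^{2iλ(t−y)} q(y) conj(q(t)) m_{L1}(t,λ,z) dt dy. -/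
open MeasureTheory Set Filter

noncomputable def mL1 (q : ℝ → ℂ) (lam : ℝ) : ℕ → ℝ → ℂ
  | 0, _ => 1
  | n + 1, x =>
      ∫ y in Ioi x, (∫ t in Ioi y,
        Complex.exp (2 * Complex.I * (lam : ℂ) * ((t : ℂ) - (y : ℂ))) * q y *
          (starRingEnd ℂ) (q t) * mL1 q lam n t)

noncomputable def ML1 (q : ℝ → ℂ) (lam : ℝ) (x : ℝ) (z : ℂ) : ℂ :=
  ∑' n : ℕ, mL1 q lam n x * z ^ (2 * n)


lemma aux_cont_tail {E : Type*} [NormedAddCommGroup E] [NormedSpace ℝ E] (g : ℝ → E)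
    (hg : Integrable g) : Continuous fun x => ∫ t in Ioi x, g t := by
  have h : (fun x => ∫ t in Ioi x, g t) = fun x => (∫ t in Ioi 0, g t) - ∫ t in (0:ℝ)..x, g t := by
    funext x
    rw [← intervalIntegral.integral_Ioi_sub_Ioi' hg.integrableOn hg.integrableOn]
    abel
  rw [h]
  exact continuous_const.sub (hg.continuous_primitive 0)

lemma aux_deriv (a : ℝ → ℝ) (hc : Continuous a) (hi : Integrable a) (x : ℝ) :
    HasDerivAt (fun x => ∫ t in Ioi x, a t) (- a x) x := by
  have h : (fun x => ∫ t in Ioi x, a t) = fun x => (∫ t in Ioi 0, a t) - ∫ t in (0:ℝ)..x, a t := by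
    funext x
    rw [← intervalIntegral.integral_Ioi_sub_Ioi' hi.integrableOn hi.integrableOn]
    abel
  rw [h]
  exact (hc.integral_hasStrictDerivAt 0 x).hasDerivAt.const_sub _

lemma aux_nonneg (a : ℝ → ℝ) (h0 : ∀ x, 0 ≤ a x) (x : ℝ) : 0 ≤ ∫ t in Ioi x, a t :=
  setIntegral_nonneg measurableSet_Ioi fun t _ => h0 t

lemma aux_int (a : ℝ → ℝ) (hc : Continuous a) (h0 : ∀ x, 0 ≤ a x) (hi : Integrable a) (k : ℕ) :
    Integrable (fun t => a t * ((∫ s in Ioi t, a s) ^ k / (k.factorial : ℝ))) := by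
  refine Integrable.mul_bdd (c := (∫ s, a s) ^ k / (k.factorial : ℝ)) hi ?_ ?_
  · exact (((aux_cont_tail a hi).pow k).div_const _).aestronglyMeasurable
  · refine Eventually.of_forall fun t => ?_
    have h1 := aux_nonneg a h0 t
    have h2 : ∫ s in Ioi t, a s ≤ ∫ s, a s :=
      setIntegral_le_integral hi (Eventually.of_forall h0)
    rw [Real.norm_of_nonneg (by positivity)]
    gcongr

lemma aux_eq (a : ℝ → ℝ) (hc : Continuous a) (h0 : ∀ x, 0 ≤ a x) (hi : Integrable a) (k : ℕ)
    (x : ℝ) :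
    ∫ t in Ioi x, a t * ((∫ s in Ioi t, a s) ^ k / (k.factorial : ℝ)) =
      (∫ s in Ioi x, a s) ^ (k + 1) / ((k + 1).factorial : ℝ) := by
  have hd : ∀ t ∈ Ici x, HasDerivAt
      (fun t => -((∫ s in Ioi t, a s) ^ (k + 1) / ((k + 1).factorial : ℝ)))
      (a t * ((∫ s in Ioi t, a s) ^ k / (k.factorial : ℝ))) t := by
    intro t _
    have := (((aux_deriv a hc hi t).pow (k + 1)).div_const ((k + 1).factorial : ℝ)).neg
    refine this.congr_deriv ?_
    rw [Nat.factorial_succ]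
    push_cast
    have : (k.factorial : ℝ) ≠ 0 := by positivity
    have : (k : ℝ) + 1 ≠ 0 := by positivity
    try simp only [Nat.add_sub_cancel]
    field_simp
  have ht : Tendsto (fun t => -((∫ s in Ioi t, a s) ^ (k + 1) / ((k + 1).factorial : ℝ)))
      atTop (nhds 0) := by
    have h : Tendsto (fun t : ℝ => ∫ s in Ioi t, a s) atTop (nhds 0) :=
      tendsto_integral_Ioi_zero tendsto_id
    simpa using ((h.pow (k + 1)).div_const ((k + 1).factorial : ℝ)).neg
  rw [integral_Ioi_of_hasDerivAt_of_tendsto' hd (aux_int a hc h0 hi k).integrableOn ht]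
  ring

/-- The kernel of the Volterra equation. -/
noncomputable def auxK (q : ℝ → ℂ) (lam : ℝ) (y t : ℝ) : ℂ :=
  Complex.exp (2 * Complex.I * (lam : ℂ) * ((t : ℂ) - (y : ℂ))) * q y * (starRingEnd ℂ) (q t)

lemma auxK_norm (q : ℝ → ℂ) (lam : ℝ) (y t : ℝ) : ‖auxK q lam y t‖ = ‖q y‖ * ‖q t‖ := by
  have : 2 * Complex.I * (lam : ℂ) * ((t : ℂ) - (y : ℂ)) =
      ((2 * lam * (t - y) : ℝ) : ℂ) * Complex.I := by
    push_cast; ring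
  simp only [auxK, this, norm_mul, Complex.norm_exp_ofReal_mul_I, RCLike.norm_conj, one_mul]

lemma aux_step (a : ℝ → ℝ) (q : ℝ → ℂ) (lam : ℝ)
    (hc : Continuous a) (h0 : ∀ x, 0 ≤ a x) (hi : Integrable a)
    (hq : Continuous q) (hqa : ∀ x, ‖q x‖ = a x) (m : ℝ → ℂ) (hm : Continuous m) (k : ℕ) (C : ℝ)
    (hb : ∀ t, ‖m t‖ ≤ C * ((∫ s in Ioi t, a s) ^ k / (k.factorial : ℝ))) :
    (∀ y, Integrable fun t => auxK q lam y t * m t) ∧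
    (∀ y, ∫ t in Ioi y, ‖auxK q lam y t * m t‖ ≤
      C * (a y * ((∫ s in Ioi y, a s) ^ (k + 1) / ((k + 1).factorial : ℝ)))) ∧
    (Integrable fun y => ∫ t in Ioi y, auxK q lam y t * m t) ∧
    (∀ x, ∫ y in Ioi x, ‖∫ t in Ioi y, auxK q lam y t * m t‖ ≤
      C * ((∫ s in Ioi x, a s) ^ (k + 2) / ((k + 2).factorial : ℝ))) := by
  have hI := aux_int a hc h0 hi k
  have hI1 := aux_int a hc h0 hi (k + 1)
  have hbd : ∀ y t, ‖auxK q lam y t * m t‖ ≤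
      (C * a y) * (a t * ((∫ s in Ioi t, a s) ^ k / (k.factorial : ℝ))) := by
    intro y t
    rw [norm_mul, auxK_norm, hqa, hqa]
    calc a y * a t * ‖m t‖ ≤ a y * a t * (C * ((∫ s in Ioi t, a s) ^ k / (k.factorial : ℝ))) :=
          mul_le_mul_of_nonneg_left (hb t) (mul_nonneg (h0 y) (h0 t))
      _ = _ := by ring
  have hint : ∀ y, Integrable fun t => auxK q lam y t * m t := by
    intro y
    refine (hI.const_mul (C * a y)).mono' ?_ (Eventually.of_forall (hbd y))
    refine Continuous.aestronglyMeasurable ?_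
    unfold auxK
    have := Complex.continuous_conj
    fun_prop
  have h2 : ∀ y, ∫ t in Ioi y, ‖auxK q lam y t * m t‖ ≤
      C * (a y * ((∫ s in Ioi y, a s) ^ (k + 1) / ((k + 1).factorial : ℝ))) := by
    intro y
    calc ∫ t in Ioi y, ‖auxK q lam y t * m t‖
        ≤ ∫ t in Ioi y, (C * a y) * (a t * ((∫ s in Ioi t, a s) ^ k / (k.factorial : ℝ))) :=
          integral_mono (hint y).norm.integrableOn (hI.const_mul (C * a y)).integrableOn (hbd y)
      _ = _ := by rw [integral_const_mul, aux_eq a hc h0 hi k y]; ring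
  have h3 : ∀ y, ‖∫ t in Ioi y, auxK q lam y t * m t‖ ≤
      C * (a y * ((∫ s in Ioi y, a s) ^ (k + 1) / ((k + 1).factorial : ℝ))) :=
    fun y => (norm_integral_le_integral_norm _).trans (h2 y)
  have hg : Integrable fun t : ℝ => Complex.exp ((2 * lam * t : ℝ) * Complex.I) *
      (starRingEnd ℂ) (q t) * m t := by
    refine (hI.const_mul C).mono' ?_ (Eventually.of_forall fun t => ?_)
    · refine Continuous.aestronglyMeasurable ?_
      have := Complex.continuous_conj
      fun_prop
    · rw [norm_mul, norm_mul, Complex.norm_exp_ofReal_mul_I, RCLike.norm_conj, hqa, one_mul]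
      calc a t * ‖m t‖ ≤ a t * (C * ((∫ s in Ioi t, a s) ^ k / (k.factorial : ℝ))) :=
            mul_le_mul_of_nonneg_left (hb t) (h0 t)
        _ = _ := by ring
  have hF : (fun y => ∫ t in Ioi y, auxK q lam y t * m t) = fun y : ℝ =>
      (Complex.exp ((-(2 * lam * y) : ℝ) * Complex.I) * q y) *
      ∫ t in Ioi y, Complex.exp ((2 * lam * t : ℝ) * Complex.I) * (starRingEnd ℂ) (q t) * m t := by
    funext y
    rw [← integral_const_mul]
    congr 1
    funext t
    have : 2 * Complex.I * (lam : ℂ) * ((t : ℂ) - (y : ℂ)) =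
      ((-(2 * lam * y) : ℝ) * Complex.I) + ((2 * lam * t : ℝ) * Complex.I) := by
      push_cast; ring
    rw [auxK, this, Complex.exp_add]
    ring
  have hFc : Continuous fun y => ∫ t in Ioi y, auxK q lam y t * m t := by
    rw [hF]
    have := aux_cont_tail _ hg
    refine Continuous.mul ?_ this
    fun_prop
  have hFi : Integrable fun y => ∫ t in Ioi y, auxK q lam y t * m t :=
    (hI1.const_mul C).mono' hFc.aestronglyMeasurable (Eventually.of_forall h3)
  refine ⟨hint, h2, hFi, fun x => ?_⟩
  calc ∫ y in Ioi x, ‖∫ t in Ioi y, auxK q lam y t * m t‖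
      ≤ ∫ y in Ioi x, C * (a y * ((∫ s in Ioi y, a s) ^ (k + 1) / ((k + 1).factorial : ℝ))) :=
        integral_mono hFi.norm.integrableOn (hI1.const_mul C).integrableOn h3
    _ = _ := by rw [integral_const_mul, aux_eq a hc h0 hi (k + 1) x]

lemma aux_m (a : ℝ → ℝ) (q : ℝ → ℂ) (lam : ℝ)
    (hc : Continuous a) (h0 : ∀ x, 0 ≤ a x) (hi : Integrable a)
    (hq : Continuous q) (hqa : ∀ x, ‖q x‖ = a x) (n : ℕ) :
    Continuous (mL1 q lam n) ∧
    ∀ t, ‖mL1 q lam n t‖ ≤ (∫ s in Ioi t, a s) ^ (2 * n) / ((2 * n).factorial : ℝ) := by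
  induction n with
  | zero =>
    have h : mL1 q lam 0 = fun _ => 1 := by funext x; simp [mL1]
    rw [h]
    exact ⟨continuous_const, fun t => by simp⟩
  | succ n ih =>
    have h : mL1 q lam (n + 1) = fun x => ∫ y in Ioi x, ∫ t in Ioi y,
        auxK q lam y t * mL1 q lam n t := by
      funext x; simp only [mL1, auxK]
    obtain ⟨-, -, h3, h4⟩ := aux_step a q lam hc h0 hi hq hqa (mL1 q lam n) ih.1 (2 * n) 1
      (fun t => by rw [one_mul]; exact ih.2 t)
    rw [h]
    refine ⟨aux_cont_tail _ h3, fun x => (norm_integral_le_integral_norm _).trans ?_⟩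
    have := h4 x
    rwa [one_mul] at this

lemma aux_volterra (a : ℝ → ℝ) (q : ℝ → ℂ) (lam : ℝ)
    (hc : Continuous a) (h0 : ∀ x, 0 ≤ a x) (hi : Integrable a)
    (hq : Continuous q) (hqa : ∀ x, ‖q x‖ = a x)
    (hs : ∀ (x : ℝ) (z : ℂ), Summable fun n : ℕ => mL1 q lam n x * z ^ (2 * n)) (x : ℝ) (z : ℂ) :
    ML1 q lam x z = 1 + z ^ 2 * ∫ y in Ioi x, ∫ t in Ioi y, auxK q lam y t * ML1 q lam t z := by
  have key := fun n : ℕ => aux_step a q lam hc h0 hi hq hqa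
    (fun t => mL1 q lam n t * z ^ (2 * n))
    ((aux_m a q lam hc h0 hi hq hqa n).1.mul continuous_const) (2 * n) (‖z‖ ^ (2 * n))
    (fun t => by
      rw [norm_mul, norm_pow, mul_comm]
      exact mul_le_mul_of_nonneg_left ((aux_m a q lam hc h0 hi hq hqa n).2 t) (by positivity))
  -- summability of the bounds
  have hsum : ∀ (r : ℝ) (j : ℕ), 0 ≤ r →
      Summable fun n : ℕ => ‖z‖ ^ (2 * n) * (r ^ (2 * n + j) / ((2 * n + j).factorial : ℝ)) := by
    intro r j hr
    refine Summable.of_nonneg_of_le (fun n => by positivity) (fun n => ?_)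
      ((Real.hasSum_cosh (‖z‖ * r)).summable.mul_left (r ^ j))
    have : ((2 * n).factorial : ℝ) ≤ ((2 * n + j).factorial : ℝ) := by
      exact_mod_cast Nat.factorial_le (by omega)
    calc ‖z‖ ^ (2 * n) * (r ^ (2 * n + j) / ((2 * n + j).factorial : ℝ))
        ≤ ‖z‖ ^ (2 * n) * (r ^ (2 * n + j) / ((2 * n).factorial : ℝ)) := by gcongr
      _ = _ := by rw [mul_pow, pow_add]; ring
  have hinner : ∀ y, HasSum (fun n : ℕ => ∫ t in Ioi y, auxK q lam y t *
      (mL1 q lam n t * z ^ (2 * n))) (∫ t in Ioi y, auxK q lam y t * ML1 q lam t z) := by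
    intro y
    have := hasSum_integral_of_summable_integral_norm (μ := volume.restrict (Ioi y))
      (F := fun (n : ℕ) t => auxK q lam y t * (mL1 q lam n t * z ^ (2 * n)))
      (fun n => ((key n).1 y).integrableOn)
      (Summable.of_nonneg_of_le (fun n => integral_nonneg fun _ => norm_nonneg _)
        (fun n => (key n).2.1 y) (by
          have := (hsum _ 1 (aux_nonneg a h0 y)).mul_left (a y)
          refine this.congr fun n => by ring))
    simpa only [ML1, tsum_mul_left] using this
  have houter := hasSum_integral_of_summable_integral_norm (μ := volume.restrict (Ioi x))
      (F := fun (n : ℕ) y => ∫ t in Ioi y, auxK q lam y t * (mL1 q lam n t * z ^ (2 * n)))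
      (fun n => (key n).2.2.1.integrableOn)
      (Summable.of_nonneg_of_le (fun n => integral_nonneg fun _ => norm_nonneg _)
        (fun n => (key n).2.2.2 x) (hsum _ 2 (aux_nonneg a h0 x)))
  simp only [fun y => (hinner y).tsum_eq] at houter
  rw [ML1, (hs x z).tsum_eq_zero_add, ← houter.tsum_eq, ← tsum_mul_left]
  congr 1
  · simp [mL1]
  · congr 1
    funext n
    simp only [← mul_assoc, integral_mul_const]
    have h : mL1 q lam (n + 1) x = ∫ y in Ioi x, ∫ t in Ioi y,
        auxK q lam y t * mL1 q lam n t := by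
      simp only [mL1, auxK]
    rw [h]
    ring

theorem stmt1
    (a : ℝ → ℝ) (q : ℝ → ℂ) (lam : ℝ)
    (ha_cont : Continuous a) (ha_nonneg : ∀ x, 0 ≤ a x) (ha_int : Integrable a)
    (hq_cont : Continuous q) (hq_abs : ∀ x, ‖q x‖ = a x) :
    ∀ x : ℝ,
      (∀ z : ℂ, Summable fun n : ℕ => ‖mL1 q lam n x * z ^ (2 * n)‖) ∧
      (∀ K : Set ℂ, IsCompact K →
        TendstoUniformlyOn (fun N z => ∑ n ∈ Finset.range N, mL1 q lam n x * z ^ (2 * n))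
          (fun z => ML1 q lam x z) atTop K) ∧
      Differentiable ℂ (fun z => ML1 q lam x z) ∧
      (∀ z : ℂ, ML1 q lam x (-z) = ML1 q lam x z) ∧
      (∀ z : ℂ, ‖ML1 q lam x z‖ ≤ Real.cosh (‖z‖ * ∫ s in Ioi x, a s)) ∧
      (∀ z : ℂ, ML1 q lam x z =
        1 + z ^ 2 * ∫ y in Ioi x, (∫ t in Ioi y,
          Complex.exp (2 * Complex.I * (lam : ℂ) * ((t : ℂ) - (y : ℂ))) * q y *
            (starRingEnd ℂ) (q t) * ML1 q lam t z)) := by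
  have hm := aux_m a q lam ha_cont ha_nonneg ha_int hq_cont hq_abs
  have hle : ∀ (x : ℝ) (z : ℂ) (R : ℝ), ‖z‖ ≤ R → ∀ n : ℕ, ‖mL1 q lam n x * z ^ (2 * n)‖ ≤
      (R * ∫ s in Ioi x, a s) ^ (2 * n) / ((2 * n).factorial : ℝ) := by
    intro x z R hR n
    have h1 := aux_nonneg a ha_nonneg x
    rw [norm_mul, norm_pow]
    calc ‖mL1 q lam n x‖ * ‖z‖ ^ (2 * n)
        ≤ ((∫ s in Ioi x, a s) ^ (2 * n) / ((2 * n).factorial : ℝ)) * R ^ (2 * n) := by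
          gcongr
          exact (hm n).2 x
      _ = _ := by rw [mul_pow]; ring
  have hsn : ∀ (x : ℝ) (z : ℂ), Summable fun n : ℕ => ‖mL1 q lam n x * z ^ (2 * n)‖ :=
    fun x z => Summable.of_nonneg_of_le (fun n => norm_nonneg _) (hle x z ‖z‖ le_rfl)
      (Real.hasSum_cosh _).summable
  intro x
  refine ⟨hsn x, ?_, ?_, ?_, ?_, ?_⟩
  · intro K hK
    obtain ⟨R, hR⟩ := hK.isBounded.exists_norm_le
    exact tendstoUniformlyOn_tsum_nat (Real.hasSum_cosh (R * ∫ s in Ioi x, a s)).summable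
      (fun n z hz => hle x z R (hR z hz) n)
  · intro z
    have hd : DifferentiableOn ℂ (fun z => ∑' n : ℕ, mL1 q lam n x * z ^ (2 * n))
        (Metric.ball 0 (‖z‖ + 1)) :=
      Complex.differentiableOn_tsum_of_summable_norm
        (Real.hasSum_cosh ((‖z‖ + 1) * ∫ s in Ioi x, a s)).summable
        (fun n => by fun_prop) Metric.isOpen_ball
        (fun n w hw => hle x w _ (by simpa using (mem_ball_zero_iff.1 hw).le) n)
    exact hd.differentiableAt (Metric.isOpen_ball.mem_nhds (by simp))
  · intro z
    simp [ML1, pow_mul]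
  · intro z
    exact tsum_of_norm_bounded (Real.hasSum_cosh _) (hle x z ‖z‖ le_rfl)
  · intro z
    exact aux_volterra a q lam ha_cont ha_nonneg ha_int hq_cont hq_abs
      (fun x z => (hsn x z).of_norm) x z
end

section
/- For every integer n ≥ 0 and every real x one has |m_{L2}^n(x)| ≤ (1/(2n+1)!) · (∫_x^{+∞} a(s) ds)^{2n+1}; consequently, for each fixed x ∈ ℝ the series m_{L2}(x,λ,z) = Σ_{n≥0} m_{L2}^n(x) z^{2n+1} converges absolutely and uniformly on compact subsets of ℂ, the map z ↦ m_{L2}(x,λ,z) is entire and odd, and |m_{L2}(x,λ,z)| ≤ sinh(|z| ∫_x^{+∞} a(s) ds) for all x ∈ ℝ and z ∈ ℂ. -/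
open MeasureTheory Set Filter

noncomputable def mL2 (q : ℝ → ℂ) (lam : ℝ) : ℕ → ℝ → ℂ
  | 0, x =>
      -Complex.I * (∫ y in Ioi x,
        Complex.exp (-(2 * Complex.I * (lam : ℂ) * ((y : ℂ) - (x : ℂ)))) * q y)
  | n + 1, x =>
      ∫ y in Ioi x, (∫ t in Ioi y,
        Complex.exp (-(2 * Complex.I * (lam : ℂ) * ((y : ℂ) - (x : ℂ)))) * q y *
          (starRingEnd ℂ) (q t) * mL2 q lam n t)

noncomputable def ML2 (q : ℝ → ℂ) (lam : ℝ) (x : ℝ) (z : ℂ) : ℂ :=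
  ∑' n : ℕ, mL2 q lam n x * z ^ (2 * n + 1)

theorem tail_hasDerivAt (a : ℝ → ℝ) (hc : Continuous a) (hi : Integrable a) (x : ℝ) :
    HasDerivAt (fun x => ∫ s in Ioi x, a s) (-a x) x := by
  have h : (fun x => ∫ s in Ioi x, a s) = fun x => (∫ s in Ioi (0 : ℝ), a s) - ∫ s in (0 : ℝ)..x, a s := by
    funext y
    have := intervalIntegral.integral_Ioi_sub_Ioi' (a := (0 : ℝ)) (b := y) (f := a) (μ := volume)
      hi.integrableOn hi.integrableOn
    linarith
  rw [h]
  exact (hc.integral_hasStrictDerivAt 0 x).hasDerivAt.const_sub _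

theorem tail_tendsto (a : ℝ → ℝ) (hi : Integrable a) :
    Tendsto (fun x => ∫ s in Ioi x, a s) atTop (nhds 0) := by
  have h : (fun x => ∫ s in Ioi x, a s) = fun x => (∫ s in Ioi (0 : ℝ), a s) - ∫ s in (0 : ℝ)..x, a s := by
    funext y
    have := intervalIntegral.integral_Ioi_sub_Ioi' (a := (0 : ℝ)) (b := y) (f := a) (μ := volume)
      hi.integrableOn hi.integrableOn
    linarith
  rw [h]
  have := (intervalIntegral_tendsto_integral_Ioi (μ := volume) (f := a) 0 hi.integrableOn
    tendsto_id).const_sub (∫ s in Ioi (0 : ℝ), a s)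
  simpa using this

theorem tail_pow (a : ℝ → ℝ) (hc : Continuous a) (h0 : ∀ x, 0 ≤ a x) (hi : Integrable a)
    (k : ℕ) (x : ℝ) :
    IntegrableOn (fun t => a t * ((1 / (k.factorial : ℝ)) * (∫ s in Ioi t, a s) ^ k)) (Ioi x) ∧
    ∫ t in Ioi x, a t * ((1 / (k.factorial : ℝ)) * (∫ s in Ioi t, a s) ^ k) =
      (1 / ((k + 1).factorial : ℝ)) * (∫ s in Ioi x, a s) ^ (k + 1) := by
  have hA : ∀ x, 0 ≤ ∫ s in Ioi x, a s := fun x => integral_nonneg h0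
  have hd : ∀ t, HasDerivAt (fun t => -((1 / ((k + 1).factorial : ℝ)) * (∫ s in Ioi t, a s) ^ (k + 1)))
      (a t * ((1 / (k.factorial : ℝ)) * (∫ s in Ioi t, a s) ^ k)) t := by
    intro t
    have h := (((tail_hasDerivAt a hc hi t).pow (k + 1)).const_mul (1 / ((k + 1).factorial : ℝ))).neg
    refine h.congr_deriv ?_
    rw [Nat.factorial_succ]
    have : (k.factorial : ℝ) ≠ 0 := by positivity
    push_cast
    have : (k : ℝ) + 1 ≠ 0 := by positivity
    field_simp
  have hn : ∀ t ∈ Ioi x, 0 ≤ a t * ((1 / (k.factorial : ℝ)) * (∫ s in Ioi t, a s) ^ k) := by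
    intro t _
    have := hA t
    have := h0 t
    positivity
  have ht : Tendsto (fun t => -((1 / ((k + 1).factorial : ℝ)) * (∫ s in Ioi t, a s) ^ (k + 1)))
      atTop (nhds 0) := by
    have := (((tail_tendsto a hi).pow (k + 1)).const_mul (1 / ((k + 1).factorial : ℝ))).neg
    simpa using this
  refine ⟨integrableOn_Ioi_deriv_of_nonneg' (fun t _ => hd t) hn ht, ?_⟩
  rw [integral_Ioi_of_hasDerivAt_of_nonneg' (fun t _ => hd t) hn ht]
  ring

theorem norm_phase (lam y x : ℝ) :
    ‖Complex.exp (-(2 * Complex.I * (lam : ℂ) * ((y : ℂ) - (x : ℂ))))‖ = 1 := by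
  have : -(2 * Complex.I * (lam : ℂ) * ((y : ℂ) - (x : ℂ))) =
      ((-(2 * lam * (y - x)) : ℝ) : ℂ) * Complex.I := by
    push_cast; ring
  rw [this, Complex.norm_exp_ofReal_mul_I]

theorem mL2_bound (a : ℝ → ℝ) (q : ℝ → ℂ) (lam : ℝ)
    (hc : Continuous a) (h0 : ∀ x, 0 ≤ a x) (hi : Integrable a)
    (hq_abs : ∀ x, ‖q x‖ = a x) (n : ℕ) : ∀ x : ℝ,
      ‖mL2 q lam n x‖ ≤ (1 / ((2 * n + 1).factorial : ℝ)) * (∫ s in Ioi x, a s) ^ (2 * n + 1) := by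
  induction n with
  | zero =>
    intro x
    simp only [mL2]
    rw [norm_mul]
    simp only [norm_neg, Complex.norm_I, one_mul]
    refine (norm_integral_le_of_norm_le (g := a) hi.integrableOn
      (Eventually.of_forall fun y => ?_)).trans ?_
    · rw [norm_mul, norm_phase, hq_abs, one_mul]
    · simp
  | succ n ih =>
    intro x
    simp only [mL2]
    obtain ⟨i2, e2⟩ := tail_pow a hc h0 hi (2 * n + 1 + 1) x
    refine (norm_integral_le_of_norm_le i2 (Eventually.of_forall fun y => ?_)).trans e2.le
    obtain ⟨i1, e1⟩ := tail_pow a hc h0 hi (2 * n + 1) y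
    rw [← e1, ← integral_const_mul]
    refine norm_integral_le_of_norm_le (i1.const_mul (a y)) (Eventually.of_forall fun t => ?_)
    rw [norm_mul, norm_mul, norm_mul, norm_phase, hq_abs, RCLike.norm_conj, hq_abs, one_mul,
      mul_assoc]
    exact mul_le_mul_of_nonneg_left (mul_le_mul_of_nonneg_left (ih t) (h0 t)) (h0 y)

theorem stmt2
    (a : ℝ → ℝ) (q : ℝ → ℂ) (lam : ℝ)
    (ha_cont : Continuous a) (ha_nonneg : ∀ x, 0 ≤ a x) (ha_int : Integrable a)
    (hq_cont : Continuous q) (hq_abs : ∀ x, ‖q x‖ = a x) :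
    (∀ (n : ℕ) (x : ℝ),
      ‖mL2 q lam n x‖ ≤ (1 / ((2 * n + 1).factorial : ℝ)) * (∫ s in Ioi x, a s) ^ (2 * n + 1)) ∧
    ∀ x : ℝ,
      (∀ z : ℂ, Summable fun n : ℕ => ‖mL2 q lam n x * z ^ (2 * n + 1)‖) ∧
      (∀ K : Set ℂ, IsCompact K →
        TendstoUniformlyOn (fun N z => ∑ n ∈ Finset.range N, mL2 q lam n x * z ^ (2 * n + 1))
          (fun z => ML2 q lam x z) atTop K) ∧
      Differentiable ℂ (fun z => ML2 q lam x z) ∧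
      (∀ z : ℂ, ML2 q lam x (-z) = -ML2 q lam x z) ∧
      (∀ z : ℂ, ‖ML2 q lam x z‖ ≤ Real.sinh (‖z‖ * ∫ s in Ioi x, a s)) := by
  have hb := mL2_bound a q lam ha_cont ha_nonneg ha_int hq_abs
  refine ⟨hb, fun x => ?_⟩
  have hA : 0 ≤ ∫ s in Ioi x, a s := integral_nonneg ha_nonneg
  have hterm : ∀ (R : ℝ) (n : ℕ) (z : ℂ), ‖z‖ ≤ R → ‖mL2 q lam n x * z ^ (2 * n + 1)‖ ≤
      (R * ∫ s in Ioi x, a s) ^ (2 * n + 1) / ((2 * n + 1).factorial : ℝ) := by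
    intro R n z hz
    rw [norm_mul, norm_pow]
    calc _ ≤ ((1 / ((2 * n + 1).factorial : ℝ)) * (∫ s in Ioi x, a s) ^ (2 * n + 1)) *
          R ^ (2 * n + 1) := by
          gcongr
          exact hb n x
      _ = _ := by rw [mul_pow]; ring
  have hs : ∀ R : ℝ, HasSum (fun n : ℕ =>
      (R * ∫ s in Ioi x, a s) ^ (2 * n + 1) / ((2 * n + 1).factorial : ℝ)) _ :=
    fun R => Real.hasSum_sinh _
  refine ⟨fun z => ?_, fun K hK => ?_, ?_, fun z => ?_, fun z => ?_⟩
  · exact Summable.of_nonneg_of_le (fun _ => norm_nonneg _) (fun n => hterm ‖z‖ n z le_rfl)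
      (hs ‖z‖).summable
  · obtain ⟨R, hR⟩ := hK.isBounded.exists_norm_le
    exact tendstoUniformlyOn_tsum_nat (hs R).summable (fun n z hz => hterm R n z (hR z hz))
  · intro z
    have h : DifferentiableOn ℂ (fun z => ML2 q lam x z) (Metric.ball 0 (‖z‖ + 1)) := by
      refine Complex.differentiableOn_tsum_of_summable_norm (hs (‖z‖ + 1)).summable
        (fun n => by fun_prop) Metric.isOpen_ball (fun n w hw => hterm _ n w ?_)
      exact (mem_ball_zero_iff.1 hw).le
    exact h.differentiableAt (Metric.isOpen_ball.mem_nhds (by simp))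
  · unfold ML2
    rw [← tsum_neg]
    congr 1
    funext n
    rw [Odd.neg_pow ⟨n, rfl⟩, mul_neg]
  · exact tsum_of_norm_bounded (hs ‖z‖) (fun n => hterm ‖z‖ n z le_rfl)
end
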